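/- (Hoffman's exponential is a tortkara morphism for areas.) Let D = ⨁_{n≥1} Dₙ, where D₁ = span 𝔄 and D_{n+1} = span{ area(φ, ψ) : φ ∈ D_{n+1−m}, ψ ∈ D_m, 1 ≤ m ≤ n }. Then for all φ, ψ ∈ D, Φ_H(area(φ, ψ)) = darea(Φ_H(φ), Φ_H(ψ)). -/

import Mathlib

noncomputable section

open scoped BigOperators

namespace TimeWarp

/-- The free commutative semigroup `𝔄` on the alphabet `A = {1,…,d}` (modelled as `Fin d`):
its elements are the nonempty finite multisets of letters, multiplied by union. -/
abbrev Bracket (d : ℕ) := {m : Multiset (Fin d) // m ≠ 0}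

instance {d : ℕ} : Mul (Bracket d) :=
  ⟨fun a b => ⟨a.1 + b.1, fun h => a.2 (by
    have hc := Multiset.card_add a.1 b.1
    rw [h] at hc
    simp at hc
    exact Multiset.card_eq_zero.mp (by omega))⟩⟩

/-- Words with letters in the semigroup `𝔄`; the basis of the tensor algebra `T(𝔄)`. -/
abbrev Word (d : ℕ) := List (Bracket d)

/-- The tensor algebra `T(𝔄)`, as the free vector space on words. -/
abbrev TA (K : Type*) [Field K] (d : ℕ) := Word d →₀ K

/-- The weight grading: each bracket has weight the number of letters in it. -/
def wordWeight {d : ℕ} (w : Word d) : ℕ := (w.map fun a => Multiset.card a.1).sum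

variable {K : Type*} [Field K] {d : ℕ}
/-- Quasi-shuffle product on (reversed) words: the head of the list is the *last* letter
of the word.  `qshRev (u ++ [a]).reverse (v ++ [b]).reverse` encodes
`ua ⋆ vb = (u ⋆ vb)a + (ua ⋆ v)b + (u ⋆ v)[ab]`. -/
def qshRev : Word d → Word d → TA K d
  | [], v => Finsupp.single v 1
  | u, [] => Finsupp.single u 1
  | a :: u, b :: v =>
      Finsupp.mapDomain (a :: ·) (qshRev u (b :: v)) +
      Finsupp.mapDomain (b :: ·) (qshRev (a :: u) v) +
      Finsupp.mapDomain ((a * b) :: ·) (qshRev u v)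
termination_by u v => u.length + v.length
decreasing_by all_goals (simp only [List.length_cons]; omega)

/-- The quasi-shuffle product `u ⋆ v` of two words, an element of `T(𝔄)`. -/
def qshW (u v : Word d) : TA K d :=
  Finsupp.mapDomain List.reverse (qshRev u.reverse v.reverse)

/-- The bilinear extension of the quasi-shuffle product to all of `T(𝔄)`. -/
def qshL (f g : TA K d) : TA K d :=
  f.sum fun u cu => g.sum fun v cv => (cu * cv) • qshW u v
/-- Shuffle product on (reversed) words: the head of the list is the *last* letter of the
word.  This encodes `ua ⧢ vb = (u ⧢ vb)a + (ua ⧢ v)b`. -/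
def shRev : Word d → Word d → TA K d
  | [], v => Finsupp.single v 1
  | u, [] => Finsupp.single u 1
  | a :: u, b :: v =>
      Finsupp.mapDomain (a :: ·) (shRev u (b :: v)) +
      Finsupp.mapDomain (b :: ·) (shRev (a :: u) v)
termination_by u v => u.length + v.length
decreasing_by all_goals (simp only [List.length_cons]; omega)

/-- The shuffle product `u ⧢ v` of two words, an element of `T(𝔄)`. -/
def shW (u v : Word d) : TA K d :=
  Finsupp.mapDomain List.reverse (shRev u.reverse v.reverse)

/-- The bilinear extension of the shuffle product to all of `T(𝔄)`. -/
def shL (f g : TA K d) : TA K d :=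
  f.sum fun u cu => g.sum fun v cv => (cu * cv) • shW u v
/-- Right quasi half-shuffle on words: `ua ⋗ vb := (ua ⋆ v)b` (zero if the second word is empty). -/
def rSuccQ (u v : Word d) : TA K d :=
  match v.getLast? with
  | none => 0
  | some b => Finsupp.mapDomain (· ++ [b]) (qshW u v.dropLast)

/-- Left quasi half-shuffle on words: `ua ⋖ vb := (u ⋆ vb)a` (zero if the first word is empty). -/
def lPrecQ (u v : Word d) : TA K d :=
  match u.getLast? with
  | none => 0
  | some a => Finsupp.mapDomain (· ++ [a]) (qshW u.dropLast v)

/-- Diamond part of the quasi-shuffle: `ua ⋄ vb := (u ⋆ v)[ab]` (zero if either word is empty). -/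
def diamQ (u v : Word d) : TA K d :=
  match u.getLast?, v.getLast? with
  | some a, some b => Finsupp.mapDomain (· ++ [a * b]) (qshW u.dropLast v.dropLast)
  | _, _ => 0

/-- Bilinear extension of `⋗`. -/
def rSuccL (f g : TA K d) : TA K d :=
  f.sum fun u cu => g.sum fun v cv => (cu * cv) • rSuccQ u v

/-- Bilinear extension of `⋖`. -/
def lPrecL (f g : TA K d) : TA K d :=
  f.sum fun u cu => g.sum fun v cv => (cu * cv) • lPrecQ u v

/-- Bilinear extension of `⋄`. -/
def diamL (f g : TA K d) : TA K d :=
  f.sum fun u cu => g.sum fun v cv => (cu * cv) • diamQ u v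
/-- Right half-shuffle (shuffle case) on words: `ua ≻ vb := (ua ⧢ v)b`
(zero if the second word is empty). -/
def rSuccSh (u v : Word d) : TA K d :=
  match v.getLast? with
  | none => 0
  | some b => Finsupp.mapDomain (· ++ [b]) (shW u v.dropLast)

/-- The (shuffle) area of two words: `area(u,v) = u ≻ v − v ≻ u`. -/
def areaW (u v : Word d) : TA K d := rSuccSh u v - rSuccSh v u

/-- The discrete (quasi-shuffle) area of two words: `darea(u,v) = u ⋗ v − v ⋗ u`. -/
def dareaW (u v : Word d) : TA K d := rSuccQ u v - rSuccQ v u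

/-- Bilinear extension of `area`. -/
def areaL (f g : TA K d) : TA K d :=
  f.sum fun u cu => g.sum fun v cv => (cu * cv) • areaW u v

/-- Bilinear extension of `darea`. -/
def dareaL (f g : TA K d) : TA K d :=
  f.sum fun u cu => g.sum fun v cv => (cu * cv) • dareaW u v
/-- Product (in the semigroup `𝔄`) of the letters of a nonempty block. -/
def blockProd : Word d → Option (Bracket d)
  | [] => none
  | a :: t => some (t.foldl (· * ·) a)

/-- `I[w]`: contract the word `w` along the composition `I`, multiplying the letters
inside each block in the semigroup `𝔄`. -/
def Iword {n : ℕ} (c : Composition n) (w : Word d) : Word d :=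
  (w.splitWrtComposition c).filterMap blockProd
/-- Hoffman's exponential `Φ_H` on a word:
`Φ_H(w) = Σ_{(i₁,…,i_p) ∈ C(ℓ(w))} (i₁!⋯i_p!)⁻¹ I[w]`. -/
def hoffExpW (w : Word d) : TA K d :=
  ∑ c : Composition w.length,
    ((c.blocks.map fun i => (i.factorial : K)).prod)⁻¹ • Finsupp.single (Iword c w) 1

/-- Linear extension of Hoffman's exponential to `T(𝔄)`. -/
def hoffExpL (f : TA K d) : TA K d := f.sum fun w c => c • hoffExpW w

/-- The spaces `Dₙ` of iterated areas: `D₁ = span 𝔄` and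
`D_{n+1} = span{ area(φ, ψ) : φ ∈ D_{n+1−m}, ψ ∈ D_m, 1 ≤ m ≤ n }`. -/
def Dsp : ℕ → Submodule K (TA K d)
  | 0 => ⊥
  | 1 => Submodule.span K {f : TA K d | ∃ a : Bracket d, f = Finsupp.single [a] 1}
  | n + 2 =>
      Submodule.span K
        (⋃ (m : ℕ) (_ : 1 ≤ m) (_ : m ≤ n + 1),
          {f : TA K d | ∃ φ ∈ Dsp (n + 2 - m), ∃ ψ ∈ Dsp m, f = areaL φ ψ})
termination_by n => n
decreasing_by all_goals omega


section Bilinear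

variable {α β M : Type*} [AddCommMonoid M] [Module K M]

/-- The bilinear map on free vector spaces with prescribed values on basis elements. -/
def bilin (W : α → β → M) : (α →₀ K) →ₗ[K] (β →₀ K) →ₗ[K] M :=
  Finsupp.linearCombination K fun u => Finsupp.linearCombination K (W u)

@[simp]
theorem bilin_single (W : α → β → M) (u : α) (v : β) :
    bilin W (Finsupp.single u (1 : K)) (Finsupp.single v 1) = W u v := by
  simp [bilin]

theorem bilin_apply (W : α → β → M) (f : α →₀ K) (g : β →₀ K) :
    bilin W f g = f.sum fun u cu => g.sum fun v cv => (cu * cv) • W u v := by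
  simp [bilin, Finsupp.linearCombination_apply, Finsupp.sum, Finset.smul_sum, mul_smul]

theorem linearMap_ext_single {f g : (α →₀ K) →ₗ[K] M}
    (h : ∀ u, f (Finsupp.single u 1) = g (Finsupp.single u 1)) : f = g := by
  ext u
  simpa using h u

theorem bilinear_ext_single {f g : (α →₀ K) →ₗ[K] (β →₀ K) →ₗ[K] M}
    (h : ∀ u v, f (Finsupp.single u 1) (Finsupp.single v 1) =
      g (Finsupp.single u 1) (Finsupp.single v 1)) : f = g :=
  linearMap_ext_single fun u => linearMap_ext_single fun v => h u v

end Bilinear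

section DividedPowers

variable {P R : Type*} [AddCommMonoid P] [Module K P] [AddCommMonoid R] [Module K R]

/-- The general Leibniz rule for a derivation of a bilinear product. -/
theorem iterate_leibniz (N : P →ₗ[K] P) (μ : P →ₗ[K] P →ₗ[K] P)
    (h : ∀ x y, N (μ x y) = μ (N x) y + μ x (N y)) (x y : P) (k : ℕ) :
    (N ^ k) (μ x y) = ∑ ij ∈ Finset.HasAntidiagonal.antidiagonal k,
      k.choose ij.1 • μ ((N ^ ij.1) x) ((N ^ ij.2) y) := by
  induction k with
  | zero => simp
  | succ k ih =>
    rw [Finset.sum_antidiagonal_choose_succ_nsmul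
      (fun i j => μ ((N ^ i) x) ((N ^ j) y)) k, pow_succ', Module.End.mul_apply, ih]
    simp only [map_sum, map_nsmul, h, smul_add, Finset.sum_add_distrib, pow_succ',
      Module.End.mul_apply]
    rw [add_comm]
    congr 1
    refine Finset.sum_congr rfl fun ij hij => ?_
    rw [Nat.choose_symm_of_eq_add (Finset.HasAntidiagonal.mem_antidiagonal.mp hij).symm]

theorem sum_antidiagonal_eq_sum_range {f : ℕ → ℕ → R} {p q : ℕ}
    (hp : ∀ i j, p ≤ i → f i j = 0) (hq : ∀ i j, q ≤ j → f i j = 0) :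
    ∑ k ∈ Finset.range (p + q), ∑ ij ∈ Finset.HasAntidiagonal.antidiagonal k, f ij.1 ij.2 =
      ∑ i ∈ Finset.range p, ∑ j ∈ Finset.range q, f i j := by
  rw [← Finset.sum_product',
    ← Finset.sum_fiberwise_of_maps_to (t := Finset.range (p + q)) (g := fun ij : ℕ × ℕ => ij.1 + ij.2)]
  · refine Finset.sum_congr rfl fun k _ => (Finset.sum_subset ?_ ?_).symm
    · intro ij hij
      simp_all
    · rintro ⟨i, j⟩ hij hn
      simp only [Finset.HasAntidiagonal.mem_antidiagonal, Finset.mem_filter, Finset.mem_product,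
        Finset.mem_range] at hij hn
      by_cases hi : i < p
      · exact hq _ _ (by grind)
      · exact hp _ _ (by omega)
  · rintro ⟨i, j⟩ hij
    simp only [Finset.mem_product, Finset.mem_range] at hij ⊢
    omega

/-- The exponential of a locally nilpotent derivation is multiplicative. -/
theorem sum_inv_factorial_iterate_mul [CharZero K] (N : P →ₗ[K] P) (μ : P →ₗ[K] P →ₗ[K] P)
    (h : ∀ x y, N (μ x y) = μ (N x) y + μ x (N y)) {x y : P} {p q : ℕ}
    (hx : (N ^ p) x = 0) (hy : (N ^ q) y = 0) :
    ∑ k ∈ Finset.range (p + q), (k.factorial : K)⁻¹ • (N ^ k) (μ x y) =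
      ∑ i ∈ Finset.range p, ∑ j ∈ Finset.range q,
        ((i.factorial : K)⁻¹ * (j.factorial : K)⁻¹) • μ ((N ^ i) x) ((N ^ j) y) := by
  rw [← sum_antidiagonal_eq_sum_range]
  · refine Finset.sum_congr rfl fun k _ => ?_
    rw [iterate_leibniz N μ h, Finset.smul_sum]
    refine Finset.sum_congr rfl fun ij hij => ?_
    rw [← Finset.HasAntidiagonal.mem_antidiagonal.mp hij, ← Nat.cast_smul_eq_nsmul K, smul_smul]
    congr 1
    have hc : (((ij.1 + ij.2).choose ij.1 * ij.1.factorial * ij.2.factorial : ℕ) : K) =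
        ((ij.1 + ij.2).factorial : K) := by
      rw [Nat.choose_symm_add, Nat.add_choose_mul_factorial_mul_factorial]
    have h1 : (ij.1.factorial : K) ≠ 0 := by exact_mod_cast Nat.factorial_ne_zero _
    have h2 : (ij.2.factorial : K) ≠ 0 := by exact_mod_cast Nat.factorial_ne_zero _
    have h3 : ((ij.1 + ij.2).factorial : K) ≠ 0 := by exact_mod_cast Nat.factorial_ne_zero _
    push_cast at hc
    field_simp
    rw [← hc]
  · intro i j hi
    simp [Module.End.pow_map_zero_of_le hi hx]
  · intro i j hj
    simp [Module.End.pow_map_zero_of_le hj hy]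

theorem iterate_mul_eq_zero (N : P →ₗ[K] P) (μ : P →ₗ[K] P →ₗ[K] P)
    (h : ∀ x y, N (μ x y) = μ (N x) y + μ x (N y)) {x y : P} {p q : ℕ}
    (hx : (N ^ p) x = 0) (hy : (N ^ q) y = 0) : (N ^ (p + q)) (μ x y) = 0 := by
  rw [iterate_leibniz N μ h]
  refine Finset.sum_eq_zero fun ij hij => ?_
  have := Finset.HasAntidiagonal.mem_antidiagonal.mp hij
  by_cases hi : p ≤ ij.1
  · simp [Module.End.pow_map_zero_of_le hi hx]
  · simp [Module.End.pow_map_zero_of_le (show q ≤ ij.2 by omega) hy]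

end DividedPowers

section Composition

/-- Compositions of a positive number, sorted by their last block. -/
theorem sum_composition_eq_sum_last {M : Type*} [AddCommMonoid M] (n : ℕ) (hn : n ≠ 0)
    (g : List ℕ → M) :
    ∑ c : Composition n, g c.blocks =
      ∑ k ∈ Finset.range n, ∑ c : Composition (n - (k + 1)), g (c.blocks ++ [k + 1]) := by
  rw [Finset.sum_sigma']
  symm
  refine Finset.sum_bij (fun x hx => (⟨x.2.blocks ++ [x.1 + 1], ?_, ?_⟩ : Composition n))
    ?_ ?_ ?_ ?_
  · intro i hi
    rcases List.mem_append.mp hi with h | h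
    · exact x.2.blocks_pos h
    · simp at h
      omega
  · have := Finset.mem_range.mp (Finset.mem_sigma.mp hx).1
    simp only [List.sum_append, x.2.blocks_sum, List.sum_cons, List.sum_nil]
    omega
  · simp
  · rintro ⟨k, c⟩ _ ⟨k', c'⟩ _ h
    have h' := congrArg Composition.blocks h
    simp only [List.append_singleton_inj] at h'
    obtain ⟨h1, h2⟩ := h'
    obtain rfl : k = k' := by omega
    obtain rfl : c = c' := Composition.ext h1
    rfl
  · intro c _
    have hne : c.blocks ≠ [] := by
      intro h
      have := c.blocks_sum
      simp [h] at this
      omega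
    have hd := List.dropLast_append_getLast hne
    have hpos := c.blocks_pos (List.getLast_mem hne)
    have hsum := c.blocks_sum
    rw [← hd] at hsum
    simp only [List.sum_append, List.sum_cons, List.sum_nil] at hsum
    refine ⟨⟨c.blocks.getLast hne - 1, ⟨c.blocks.dropLast,
      fun h => c.blocks_pos (List.mem_of_mem_dropLast h), by omega⟩⟩, ?_, ?_⟩
    · simp
      omega
    · apply Composition.ext
      simp only
      rw [Nat.sub_add_cancel hpos, hd]
  · intros
    rfl

theorem splitWrtCompositionAux_append_singleton {α : Type*} (l : List α) (bs : List ℕ) (j : ℕ) :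
    l.splitWrtCompositionAux (bs ++ [j]) =
      (l.take bs.sum).splitWrtCompositionAux bs ++ [(l.drop bs.sum).take j] := by
  induction bs generalizing l with
  | nil => simp [List.splitWrtCompositionAux]
  | cons b bs ih =>
    simp [List.splitWrtCompositionAux_cons, ih, List.take_take, List.drop_take]

end Composition

section Operators

/-- The product of the letters of a word as a multiset, with `0` for the empty word. -/
def letterSum (w : Word d) : Multiset (Fin d) := (w.map Subtype.val).sum

/-- Reversed words together with a pending last block. -/
abbrev Pending (K : Type*) [Field K] (d : ℕ) := (Word d × Multiset (Fin d)) →₀ K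

/-- Attach a pending block to reversed words. -/
def pend (m : Multiset (Fin d)) : TA K d →ₗ[K] Pending K d :=
  Finsupp.lmapDomain K K fun w => (w, m)

@[simp]
theorem pend_single (m : Multiset (Fin d)) (w : Word d) (c : K) :
    pend m (Finsupp.single w c) = Finsupp.single (w, m) c := by
  simp [pend]

/-- Move the last letter of a word into the pending block. -/
def absorb : Pending K d →ₗ[K] Pending K d :=
  Finsupp.linearCombination K fun x => match x.1 with
    | [] => 0
    | a :: u => Finsupp.single (u, a.1 + x.2) 1

@[simp]
theorem absorb_nil (m : Multiset (Fin d)) :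
    absorb (Finsupp.single (([] : Word d), m) (1 : K)) = 0 := by
  simp [absorb]

@[simp]
theorem absorb_cons (a : Bracket d) (u : Word d) (m : Multiset (Fin d)) :
    absorb (Finsupp.single (a :: u, m) (1 : K)) = Finsupp.single (u, a.1 + m) 1 := by
  simp [absorb]

theorem absorb_pend_cons (a : Bracket d) (m : Multiset (Fin d)) (x : TA K d) :
    absorb (pend m (Finsupp.mapDomain (a :: ·) x)) = pend (a.1 + m) x := by
  have : (absorb ∘ₗ pend m ∘ₗ Finsupp.lmapDomain K K (a :: ·)) = pend (K := K) (a.1 + m) :=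
    linearMap_ext_single fun u => by simp
  exact LinearMap.congr_fun this x

theorem absorb_pow_single (k : ℕ) (w : Word d) (m : Multiset (Fin d)) :
    (absorb ^ k) (Finsupp.single (w, m) (1 : K)) =
      if k ≤ w.length then Finsupp.single (w.drop k, letterSum (w.take k) + m) 1 else 0 := by
  induction k generalizing w m with
  | zero => simp [letterSum]
  | succ k ih =>
    rw [pow_succ, Module.End.mul_apply]
    cases w with
    | nil => simp
    | cons a w =>
      simp only [absorb_cons, ih, List.length_cons, Nat.add_le_add_iff_right, List.drop_succ_cons,
        List.take_succ_cons]
      congr 3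
      simp only [letterSum, List.map_cons, List.sum_cons]
      abel

@[simp]
theorem shRev_nil_left (v : Word d) : (shRev [] v : TA K d) = Finsupp.single v 1 := by
  rw [shRev]

@[simp]
theorem shRev_nil_right (v : Word d) : (shRev v [] : TA K d) = Finsupp.single v 1 := by
  cases v <;> simp [shRev]

theorem shRev_cons_cons (a b : Bracket d) (u v : Word d) :
    (shRev (a :: u) (b :: v) : TA K d) = Finsupp.mapDomain (a :: ·) (shRev u (b :: v)) +
      Finsupp.mapDomain (b :: ·) (shRev (a :: u) v) := by
  rw [shRev]

theorem shRev_comm (u v : Word d) : (shRev u v : TA K d) = shRev v u := by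
  induction u generalizing v with
  | nil => simp
  | cons a u ihu =>
    induction v with
    | nil => simp
    | cons b v ihv => rw [shRev_cons_cons, shRev_cons_cons, ihu, ihv, add_comm]

/-- The shuffle product of reversed words, multiplying the pending blocks. -/
def pendProd : Pending K d →ₗ[K] Pending K d →ₗ[K] Pending K d :=
  bilin fun x y => pend (x.2 + y.2) (shRev x.1 y.1)

@[simp]
theorem pendProd_single (x y : Word d × Multiset (Fin d)) :
    pendProd (Finsupp.single x (1 : K)) (Finsupp.single y 1) =
      pend (x.2 + y.2) (shRev x.1 y.1) := by
  simp [pendProd]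

theorem pendProd_comm (x y : Pending K d) : pendProd x y = pendProd y x := by
  have : (pendProd : Pending K d →ₗ[K] _) = pendProd.flip :=
    bilinear_ext_single fun u v => by
      rw [LinearMap.flip_apply, pendProd_single, pendProd_single, add_comm, shRev_comm]
  exact LinearMap.congr_fun₂ this x y

theorem absorb_pendProd (x y : Pending K d) :
    absorb (pendProd x y) = pendProd (absorb x) y + pendProd x (absorb y) := by
  have : pendProd.compr₂ absorb =
      (pendProd ∘ₗ absorb) + pendProd.compl₂ (absorb (K := K) (d := d)) :=
    bilinear_ext_single fun u v => by
      obtain ⟨u, m⟩ := u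
      obtain ⟨v, m'⟩ := v
      rcases u with _ | ⟨a, u⟩ <;> rcases v with _ | ⟨b, v⟩
      · simp
      · simp [add_left_comm]
      · simp [add_assoc]
      · simp [shRev_cons_cons, absorb_pend_cons, add_left_comm, add_assoc]
  exact LinearMap.congr_fun₂ this x y

/-- Append a letter to every word. -/
def snoc (a : Bracket d) : TA K d →ₗ[K] TA K d := Finsupp.lmapDomain K K (· ++ [a])

theorem snoc_single (a : Bracket d) (w : Word d) (c : K) :
    snoc a (Finsupp.single w c) = Finsupp.single (w ++ [a]) c := by
  simp [snoc]

/-- Append a nonempty block to every word, and map to zero for the empty block. -/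
def close (m : Multiset (Fin d)) : TA K d →ₗ[K] TA K d :=
  if h : m ≠ 0 then snoc ⟨m, h⟩ else 0

@[simp]
theorem close_zero : close (K := K) (0 : Multiset (Fin d)) = 0 := by
  simp [close]

theorem close_of_ne_zero {m : Multiset (Fin d)} (h : m ≠ 0) :
    close (K := K) m = snoc ⟨m, h⟩ :=
  dif_pos h

theorem close_val (b : Bracket d) : close (K := K) b.1 = snoc b :=
  close_of_ne_zero b.2

/-- Hoffman's exponential of a reversed word. -/
def hoffRev (w : Word d) : TA K d := hoffExpW w.reverse

/-- Hoffman's exponential on reversed words. -/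
def hoffRevL : TA K d →ₗ[K] TA K d := Finsupp.linearCombination K hoffRev

@[simp]
theorem hoffRevL_single (w : Word d) : hoffRevL (Finsupp.single w (1 : K)) = hoffRev w := by
  simp [hoffRevL]

theorem blockProd_eq_some {w : Word d} (hw : letterSum w ≠ 0) :
    blockProd w = some ⟨letterSum w, hw⟩ := by
  have key : ∀ (t : Word d) (a : Bracket d), (t.foldl (· * ·) a).1 = a.1 + letterSum t := by
    intro t
    induction t with
    | nil => simp [letterSum]
    | cons b t ih =>
      intro a
      rw [List.foldl_cons, ih]
      simp only [letterSum, List.map_cons, List.sum_cons, ← add_assoc]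
      rfl
  cases w with
  | nil => simp [letterSum] at hw
  | cons a t =>
    rw [blockProd, Option.some_inj]
    exact Subtype.ext (by rw [key]; simp [letterSum])

theorem letterSum_ne_zero {w : Word d} (hw : w ≠ []) : letterSum w ≠ 0 := by
  cases w with
  | nil => exact absurd rfl hw
  | cons a t =>
    intro h
    simp only [letterSum, List.map_cons, List.sum_cons] at h
    exact a.2 (add_eq_zero.mp h).1

theorem letterSum_reverse (w : Word d) : letterSum w.reverse = letterSum w := by
  simp [letterSum, List.sum_reverse]

@[simp]
theorem hoffExpW_nil : (hoffExpW ([] : Word d) : TA K d) = Finsupp.single [] 1 := by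
  have h : ∀ c : Composition 0, c.blocks = [] := fun c => by simp
  simp [hoffExpW, Iword, List.splitWrtComposition, h, List.splitWrtCompositionAux, composition_card 0]

/-- Hoffman's exponential, sorted by the last block. -/
theorem hoffRev_eq_sum {w : Word d} (hw : w ≠ []) :
    (hoffRev w : TA K d) = ∑ k ∈ Finset.range w.length, ((k + 1).factorial : K)⁻¹ •
      close (letterSum (w.take (k + 1))) (hoffRev (w.drop (k + 1))) := by
  let g : Word d → List ℕ → TA K d := fun x bs =>
    ((bs.map fun i => (i.factorial : K)).prod)⁻¹ •
      Finsupp.single ((x.splitWrtCompositionAux bs).filterMap blockProd) 1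
  have hg : ∀ (x : Word d) (n : ℕ), n = x.length →
      hoffExpW x = ∑ c : Composition n, g x c.blocks := by
    rintro x _ rfl
    rfl
  rw [hoffRev, hg w.reverse w.length (by simp),
    sum_composition_eq_sum_last _ (by simpa using hw)]
  refine Finset.sum_congr rfl fun k hk => ?_
  have hk' := Finset.mem_range.mp hk
  rw [hoffRev, hg _ (w.length - (k + 1)) (by simp), map_sum, Finset.smul_sum]
  refine Finset.sum_congr rfl fun c _ => ?_
  have hne : w.take (k + 1) ≠ [] := by simpa using hw
  have htake : (w.reverse.drop (w.length - (k + 1))).take (k + 1) = (w.take (k + 1)).reverse := by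
    rw [List.drop_reverse, Nat.sub_sub_self hk', List.take_of_length_le (by simp)]
  have hb : blockProd (w.take (k + 1)).reverse =
      some ⟨letterSum (w.take (k + 1)), letterSum_ne_zero hne⟩ := by
    rw [blockProd_eq_some (letterSum_ne_zero (by simpa using hne)), Option.some_inj]
    exact Subtype.ext (letterSum_reverse _)
  simp only [g, splitWrtCompositionAux_append_singleton, c.blocks_sum, htake, List.filterMap_append,
    List.map_append, List.prod_append, close_of_ne_zero (letterSum_ne_zero hne), map_smul, smul_smul]
  rw [List.reverse_drop]
  simp only [hb, snoc_single, mul_comm, List.filterMap_cons, List.filterMap_nil, List.map_cons,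
    List.map_nil, List.prod_cons, List.prod_nil, one_mul, mul_inv]

/-- Apply Hoffman's exponential and append the pending block. -/
def finish : Pending K d →ₗ[K] TA K d :=
  Finsupp.linearCombination K fun x => close x.2 (hoffRev x.1)

@[simp]
theorem finish_single (x : Word d × Multiset (Fin d)) :
    finish (Finsupp.single x (1 : K)) = close x.2 (hoffRev x.1) := by
  simp [finish]

theorem finish_pend (m : Multiset (Fin d)) (x : TA K d) :
    finish (pend m x) = close m (hoffRevL x) := by
  have : finish ∘ₗ pend m = close m ∘ₗ hoffRevL (K := K) :=
    linearMap_ext_single fun u => by simp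
  exact LinearMap.congr_fun this x

theorem hoffRev_eq_sum_absorb {w : Word d} (hw : w ≠ []) {n : ℕ} (hn : w.length < n) :
    (hoffRev w : TA K d) = ∑ k ∈ Finset.range n, (k.factorial : K)⁻¹ •
      finish ((absorb ^ k) (Finsupp.single (w, 0) 1)) := by
  rw [Finset.eventually_constant_sum (N := w.length + 1) _ hn, Finset.sum_range_succ',
    hoffRev_eq_sum hw]
  · simp only [pow_zero, Module.End.one_apply, finish_single, close_zero, LinearMap.zero_apply,
      smul_zero, add_zero]
    refine Finset.sum_congr rfl fun k hk => ?_
    rw [absorb_pow_single, if_pos (Nat.succ_le_of_lt (Finset.mem_range.mp hk))]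
    simp
  · intro k hk
    rw [absorb_pow_single, if_neg (by omega)]
    simp

theorem hoffRevL_eq_sum_absorb {x : TA K d} (hx : x [] = 0) {n : ℕ}
    (hn : (absorb ^ n) (pend 0 x) = 0) :
    hoffRevL x = ∑ k ∈ Finset.range n, (k.factorial : K)⁻¹ •
      finish ((absorb ^ k) (pend 0 x)) := by
  have key : ∀ x : TA K d, ∃ N, ∀ n, N ≤ n → hoffRevL x = x [] • Finsupp.single [] 1 +
      ∑ k ∈ Finset.range n, (k.factorial : K)⁻¹ • finish ((absorb ^ k) (pend 0 x)) := by
    intro x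
    induction x using Finsupp.induction_linear with
    | zero => exact ⟨0, by simp⟩
    | add f g hf hg =>
      obtain ⟨N, hN⟩ := hf
      obtain ⟨N', hN'⟩ := hg
      refine ⟨max N N', fun n hn => ?_⟩
      rw [map_add, hN n (le_of_max_le_left hn), hN' n (le_of_max_le_right hn)]
      simp only [map_add, smul_add, Finset.sum_add_distrib, Finsupp.add_apply, add_smul]
      abel
    | single w c =>
      refine ⟨w.length + 1, fun n hn => ?_⟩
      rw [← mul_one c, ← smul_eq_mul, ← Finsupp.smul_single]
      simp only [map_smul, smul_comm _ c, ← Finset.smul_sum, hoffRevL_single, pend_single,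
        Finsupp.smul_apply, smul_assoc, ← smul_add]
      congr 1
      by_cases hw : w = []
      · subst hw
        have : ∀ k, (k.factorial : K)⁻¹ • finish ((absorb ^ k)
            (Finsupp.single (([] : Word d), (0 : Multiset (Fin d))) (1 : K))) = 0 := by
          intro k
          rw [absorb_pow_single]
          split_ifs <;> simp [letterSum]
        simp [hoffRev, this]
      · rw [hoffRev_eq_sum_absorb hw hn]
        simp [hw]
  obtain ⟨N, hN⟩ := key x
  rw [hN (max N n) (le_max_left _ _), hx, zero_smul, zero_add,
    Finset.eventually_constant_sum _ (le_max_right N n)]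
  intro k hk
  simp [Module.End.pow_map_zero_of_le hk hn]

end Operators

section Morphism

@[simp]
theorem qshW_nil_left (v : Word d) : (qshW [] v : TA K d) = Finsupp.single v 1 := by
  simp [qshW, qshRev]

@[simp]
theorem qshW_nil_right (v : Word d) : (qshW v [] : TA K d) = Finsupp.single v 1 := by
  have : (qshRev v.reverse [] : TA K d) = Finsupp.single v.reverse 1 := by
    cases v.reverse <;> simp [qshRev]
  simp [qshW, this]

theorem mapDomain_reverse_cons (a : Bracket d) (x : TA K d) :
    Finsupp.mapDomain List.reverse (Finsupp.mapDomain (a :: ·) x) =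
      snoc a (Finsupp.mapDomain List.reverse x) := by
  rw [snoc, Finsupp.lmapDomain_apply, ← Finsupp.mapDomain_comp, ← Finsupp.mapDomain_comp]
  congr 1
  funext w
  simp

theorem qshW_append_singleton (a b : Bracket d) (u v : Word d) :
    (qshW (u ++ [a]) (v ++ [b]) : TA K d) = snoc a (qshW u (v ++ [b])) +
      snoc b (qshW (u ++ [a]) v) + snoc (a * b) (qshW u v) := by
  simp only [qshW, List.reverse_append, List.reverse_cons, List.reverse_nil, List.nil_append,
    List.cons_append]
  rw [qshRev]
  simp only [Finsupp.mapDomain_add, mapDomain_reverse_cons]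

/-- The quasi-shuffle product as a bilinear map. -/
def quasiShuffle : TA K d →ₗ[K] TA K d →ₗ[K] TA K d := bilin qshW

theorem quasiShuffle_snoc (a b : Bracket d) (x y : TA K d) :
    quasiShuffle (snoc a x) (snoc b y) = snoc a (quasiShuffle x (snoc b y)) +
      snoc b (quasiShuffle (snoc a x) y) + snoc (a * b) (quasiShuffle x y) := by
  have : (quasiShuffle : TA K d →ₗ[K] _).compl₁₂ (snoc a) (snoc b) =
      (quasiShuffle.compl₂ (snoc b)).compr₂ (snoc a) +
      (quasiShuffle ∘ₗ snoc a).compr₂ (snoc b) + quasiShuffle.compr₂ (snoc (a * b)) :=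
    bilinear_ext_single fun u v => by
      simp [snoc_single, quasiShuffle, qshW_append_singleton]
  exact LinearMap.congr_fun₂ this x y

theorem quasiShuffle_close {m m' : Multiset (Fin d)} (hm : m ≠ 0) (hm' : m' ≠ 0) (x y : TA K d) :
    quasiShuffle (close m x) (close m' y) = close m (quasiShuffle x (close m' y)) +
      close m' (quasiShuffle (close m x) y) + close (m + m') (quasiShuffle x y) := by
  have h : m + m' ≠ 0 := fun h => hm (add_eq_zero.mp h).1
  rw [close_of_ne_zero hm, close_of_ne_zero hm', close_of_ne_zero h, quasiShuffle_snoc]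
  rfl

@[simp]
theorem hoffRev_nil : (hoffRev ([] : Word d) : TA K d) = Finsupp.single [] 1 := by
  simp [hoffRev]

theorem quasiShuffle_one_left (x : TA K d) : quasiShuffle (Finsupp.single [] 1) x = x := by
  have : (quasiShuffle : TA K d →ₗ[K] _) (Finsupp.single [] 1) = LinearMap.id :=
    linearMap_ext_single fun u => by simp [quasiShuffle]
  exact LinearMap.congr_fun this x

theorem quasiShuffle_one_right (x : TA K d) : quasiShuffle x (Finsupp.single [] 1) = x := by
  have : (quasiShuffle : TA K d →ₗ[K] _).flip (Finsupp.single [] 1) = LinearMap.id :=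
    linearMap_ext_single fun u => by simp [quasiShuffle]
  exact LinearMap.congr_fun this x

/-- Hoffman's exponential turns the shuffle product into the quasi-shuffle product. -/
theorem hoffRevL_shRev [CharZero K] (u v : Word d) :
    hoffRevL (shRev u v : TA K d) = quasiShuffle (hoffRev u) (hoffRev v) := by
  induction h : u.length + v.length using Nat.strong_induction_on generalizing u v with
  | _ n ih =>
  subst h
  by_cases hu : u = []
  · simp [hu, quasiShuffle_one_left]
  by_cases hv : v = []
  · simp [hv, quasiShuffle_one_right]
  have hnil : (shRev u v : TA K d) [] = 0 := by
    obtain ⟨a, u, rfl⟩ := List.exists_cons_of_ne_nil hu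
    obtain ⟨b, v, rfl⟩ := List.exists_cons_of_ne_nil hv
    rw [shRev_cons_cons, Finsupp.add_apply, Finsupp.mapDomain_of_notMem_range _ _ (by simp),
      Finsupp.mapDomain_of_notMem_range _ _ (by simp), add_zero]
  have hpend : pend 0 (shRev u v : TA K d) =
      pendProd (Finsupp.single (u, 0) 1) (Finsupp.single (v, 0) 1) := by
    simp
  have hnilp : ∀ w : Word d, (absorb ^ (w.length + 1))
      (Finsupp.single (w, (0 : Multiset (Fin d))) (1 : K)) = 0 := by
    intro w
    rw [absorb_pow_single, if_neg (by omega)]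
  have hzero : (absorb ^ (u.length + 1 + (v.length + 1))) (pendProd (Finsupp.single (u, 0) (1 : K))
      (Finsupp.single (v, 0) 1)) = 0 :=
    iterate_mul_eq_zero absorb pendProd absorb_pendProd (hnilp u) (hnilp v)
  rw [hoffRevL_eq_sum_absorb hnil (by rw [hpend]; exact hzero), hpend]
  simp only [← map_smul finish]
  rw [← map_sum, sum_inv_factorial_iterate_mul absorb pendProd absorb_pendProd (hnilp u) (hnilp v)]
  have hterm : ∀ i ∈ Finset.range (u.length + 1), ∀ j ∈ Finset.range (v.length + 1),
      i + j ≠ 0 → finish (pendProd ((absorb ^ i) (Finsupp.single (u, 0) 1))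
        ((absorb ^ j) (Finsupp.single (v, 0) (1 : K)))) =
      close (letterSum (u.take i) + letterSum (v.take j))
        (quasiShuffle (hoffRev (u.drop i)) (hoffRev (v.drop j))) := by
    intro i hi j hj hij
    rw [Finset.mem_range] at hi hj
    rw [absorb_pow_single, absorb_pow_single, if_pos (by omega), if_pos (by omega),
      pendProd_single, finish_pend, add_zero, add_zero,
      ih _ (by simp only [List.length_drop]; omega) _ _ rfl]
  have hclose : ∀ {w : Word d}, w ≠ [] → ∀ k, letterSum (w.take (k + 1)) ≠ 0 :=
    fun hw k => letterSum_ne_zero (by simpa using hw)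
  have hlhs : finish (∑ i ∈ Finset.range (u.length + 1), ∑ j ∈ Finset.range (v.length + 1),
      ((i.factorial : K)⁻¹ * (j.factorial : K)⁻¹) •
        pendProd ((absorb ^ i) (Finsupp.single (u, 0) 1))
          ((absorb ^ j) (Finsupp.single (v, 0) (1 : K)))) =
      ∑ i ∈ Finset.range (u.length + 1), ∑ j ∈ Finset.range (v.length + 1),
        ((i.factorial : K)⁻¹ * (j.factorial : K)⁻¹) •
          close (letterSum (u.take i) + letterSum (v.take j))
            (quasiShuffle (hoffRev (u.drop i)) (hoffRev (v.drop j))) := by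
    simp only [map_sum, map_smul]
    refine Finset.sum_congr rfl fun i hi => Finset.sum_congr rfl fun j hj => ?_
    by_cases hij : i + j = 0
    · obtain ⟨rfl, rfl⟩ : i = 0 ∧ j = 0 := by omega
      simp [letterSum, finish_pend]
    · rw [hterm i hi j hj hij]
  rw [hlhs]
  have hQ : quasiShuffle (hoffRev u : TA K d) (hoffRev v) =
      ∑ i ∈ Finset.range u.length, ∑ j ∈ Finset.range v.length,
        (((i + 1).factorial : K)⁻¹ * ((j + 1).factorial : K)⁻¹) •
          quasiShuffle (close (letterSum (u.take (i + 1))) (hoffRev (u.drop (i + 1))))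
            (close (letterSum (v.take (j + 1))) (hoffRev (v.drop (j + 1)))) := by
    rw [hoffRev_eq_sum hu, hoffRev_eq_sum hv]
    simp only [map_sum, LinearMap.sum_apply, map_smul, LinearMap.smul_apply, Finset.smul_sum,
      smul_smul]
    rw [Finset.sum_comm]
    simp only [mul_comm]
  have hQu : ∀ x : TA K d, quasiShuffle (hoffRev u) x = ∑ i ∈ Finset.range u.length,
      ((i + 1).factorial : K)⁻¹ •
        quasiShuffle (close (letterSum (u.take (i + 1))) (hoffRev (u.drop (i + 1)))) x := by
    intro x
    conv_lhs => rw [hoffRev_eq_sum hu]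
    simp only [map_sum, LinearMap.sum_apply, map_smul, LinearMap.smul_apply]
  have hQv : ∀ x : TA K d, quasiShuffle x (hoffRev v) = ∑ j ∈ Finset.range v.length,
      ((j + 1).factorial : K)⁻¹ •
        quasiShuffle x (close (letterSum (v.take (j + 1))) (hoffRev (v.drop (j + 1)))) := by
    intro x
    conv_lhs => rw [hoffRev_eq_sum hv]
    simp only [map_sum, map_smul]
  rw [hQ]
  simp only [quasiShuffle_close (hclose hu _) (hclose hv _), smul_add, Finset.sum_add_distrib]
  rw [Finset.sum_range_succ', Finset.sum_range_succ' _ v.length]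
  simp only [Finset.sum_range_succ' _ v.length, Finset.sum_add_distrib, List.take_zero,
    List.drop_zero, letterSum, List.map_nil, List.sum_nil, add_zero, zero_add, close_zero,
    LinearMap.zero_apply, smul_zero, Nat.factorial_zero, Nat.cast_one, inv_one, one_mul, mul_one]
  simp only [hQu, hQv, map_sum, map_smul, Finset.smul_sum, smul_smul]
  rw [Finset.sum_comm (s := Finset.range v.length)]
  simp only [mul_comm]
  abel

end Morphism

section Areas

/-- The pending form of a (non-reversed) element, with no block pending. -/
def start : TA K d →ₗ[K] Pending K d := pend 0 ∘ₗ Finsupp.lmapDomain K K List.reverse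

theorem start_single (w : Word d) (c : K) :
    start (Finsupp.single w c) = Finsupp.single (w.reverse, 0) c := by
  simp [start]

theorem hoffExpL_eq (f : TA K d) :
    hoffExpL f = hoffRevL (Finsupp.mapDomain List.reverse f) := by
  rw [hoffRevL, Finsupp.linearCombination_mapDomain, Finsupp.linearCombination_apply, hoffExpL]
  simp [hoffRev]

/-- The shuffle half-product as a bilinear map. -/
def halfShuffle : TA K d →ₗ[K] TA K d →ₗ[K] TA K d := bilin rSuccSh

/-- The quasi-shuffle half-product as a bilinear map. -/
def halfQuasiShuffle : TA K d →ₗ[K] TA K d →ₗ[K] TA K d := bilin rSuccQ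

theorem areaL_eq (f g : TA K d) : areaL f g = halfShuffle f g - halfShuffle g f := by
  have : (bilin areaW : TA K d →ₗ[K] TA K d →ₗ[K] TA K d) + halfShuffle.flip =
      halfShuffle :=
    bilinear_ext_single fun u v => by simp [halfShuffle, areaW]
  rw [areaL, ← bilin_apply]
  exact eq_sub_of_add_eq (LinearMap.congr_fun₂ this f g)

theorem dareaL_eq (f g : TA K d) : dareaL f g = halfQuasiShuffle f g - halfQuasiShuffle g f := by
  have : (bilin dareaW : TA K d →ₗ[K] TA K d →ₗ[K] TA K d) + halfQuasiShuffle.flip =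
      halfQuasiShuffle :=
    bilinear_ext_single fun u v => by simp [halfQuasiShuffle, dareaW]
  rw [dareaL, ← bilin_apply]
  exact eq_sub_of_add_eq (LinearMap.congr_fun₂ this f g)

theorem rSuccSh_nil (u : Word d) : (rSuccSh u [] : TA K d) = 0 := by
  simp [rSuccSh]

theorem rSuccSh_append_singleton (u v : Word d) (b : Bracket d) :
    (rSuccSh u (v ++ [b]) : TA K d) = snoc b (shW u v) := by
  simp [rSuccSh, snoc]

theorem halfShuffle_apply_nil (f g : TA K d) : halfShuffle f g [] = 0 := by
  have : (halfShuffle : TA K d →ₗ[K] _).compr₂ (Finsupp.lapply []) = 0 :=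
    bilinear_ext_single fun u v => by
      rcases List.eq_nil_or_concat' v with rfl | ⟨v, b, rfl⟩
      · simp [halfShuffle, rSuccSh_nil]
      · simp only [LinearMap.compr₂_apply, halfShuffle, bilin_single, rSuccSh_append_singleton,
          snoc, Finsupp.lmapDomain_apply, Finsupp.lapply_apply, LinearMap.zero_apply]
        exact Finsupp.mapDomain_of_notMem_range _ _ (by simp)
  exact LinearMap.congr_fun₂ this f g

theorem start_snoc (b : Bracket d) (x : TA K d) :
    start (snoc b (Finsupp.mapDomain List.reverse x)) =
      pend 0 (Finsupp.mapDomain (b :: ·) x) := by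
  rw [start, LinearMap.comp_apply, ← mapDomain_reverse_cons, Finsupp.lmapDomain_apply,
    ← Finsupp.mapDomain_comp (f := List.reverse) (g := List.reverse)]
  simp

theorem absorb_start_halfShuffle (f g : TA K d) :
    absorb (start (halfShuffle f g)) = pendProd (start f) (absorb (start g)) := by
  have : (halfShuffle : TA K d →ₗ[K] _).compr₂ (absorb ∘ₗ start) =
      pendProd.compl₁₂ start (absorb ∘ₗ start) :=
    bilinear_ext_single fun u v => by
      rcases List.eq_nil_or_concat' v with rfl | ⟨v, b, rfl⟩
      · simp [halfShuffle, rSuccSh_nil, start_single]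
      · simp [halfShuffle, rSuccSh_append_singleton, start_single, shW, start_snoc,
          absorb_pend_cons]
  exact LinearMap.congr_fun₂ this f g

theorem halfQuasiShuffle_snoc (b : Bracket d) (x y : TA K d) :
    halfQuasiShuffle x (snoc b y) = snoc b (quasiShuffle x y) := by
  have : (halfQuasiShuffle : TA K d →ₗ[K] _).compl₂ (snoc b) = quasiShuffle.compr₂ (snoc b) :=
    bilinear_ext_single fun u v => by
      simp only [LinearMap.compl₂_apply, LinearMap.compr₂_apply, snoc_single, halfQuasiShuffle,
        quasiShuffle, bilin_single]
      simp [rSuccQ, snoc]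
  exact LinearMap.congr_fun₂ this x y

theorem finish_absorb_start_halfShuffle [CharZero K] (f g : TA K d) :
    finish (absorb (start (halfShuffle f g))) =
      halfQuasiShuffle (hoffExpL f) (finish (absorb (start g))) := by
  have : (halfShuffle : TA K d →ₗ[K] _).compr₂ (finish ∘ₗ absorb ∘ₗ start) =
      halfQuasiShuffle.compl₁₂ (hoffRevL ∘ₗ Finsupp.lmapDomain K K List.reverse)
        (finish ∘ₗ absorb ∘ₗ start) :=
    bilinear_ext_single fun u v => by
      simp only [LinearMap.compr₂_apply, LinearMap.compl₁₂_apply, LinearMap.comp_apply,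
        absorb_start_halfShuffle]
      rcases List.eq_nil_or_concat' v with rfl | ⟨v, b, rfl⟩
      · simp [start_single]
      · simp [start_single, finish_pend, close_val, hoffRevL_shRev, halfQuasiShuffle_snoc]
  rw [hoffExpL_eq]
  exact LinearMap.congr_fun₂ this f g

/-- Elements without constant term whose last two letters vanish after symmetrization. -/
def areaLike : Submodule K (TA K d) :=
  LinearMap.ker (Finsupp.lapply (R := K) ([] : Word d)) ⊓
    LinearMap.ker ((absorb ^ 2) ∘ₗ (start : TA K d →ₗ[K] _))

theorem mem_areaLike {f : TA K d} :
    f ∈ areaLike ↔ f [] = 0 ∧ absorb (absorb (start f)) = 0 := by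
  simp [areaLike, pow_two]

theorem areaL_mem_areaLike {f g : TA K d} (hf : f ∈ areaLike) (hg : g ∈ areaLike) :
    areaL f g ∈ areaLike := by
  rw [mem_areaLike] at *
  rw [areaL_eq]
  refine ⟨by simp [halfShuffle_apply_nil], ?_⟩
  simp only [map_sub, absorb_start_halfShuffle, absorb_pendProd, hf.2, hg.2, map_zero, add_zero]
  rw [pendProd_comm, sub_self]

theorem Dsp_le_areaLike (n : ℕ) : Dsp (K := K) (d := d) n ≤ areaLike := by
  induction n using Nat.strong_induction_on with
  | _ n ih =>
  match n with
  | 0 => simp [Dsp]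
  | 1 =>
    rw [Dsp, Submodule.span_le]
    rintro _ ⟨a, rfl⟩
    exact mem_areaLike.mpr ⟨by simp, by simp [start_single]⟩
  | n + 2 =>
    rw [Dsp, Submodule.span_le]
    intro f hf
    simp only [Set.mem_iUnion] at hf
    obtain ⟨m, h1, h2, φ, hφ, ψ, hψ, rfl⟩ := hf
    exact areaL_mem_areaLike (ih _ (by omega) hφ) (ih _ (by omega) hψ)

theorem hoffExpL_of_mem_areaLike {f : TA K d} (hf : f ∈ areaLike) :
    hoffExpL f = finish (absorb (start f)) := by
  rw [mem_areaLike] at hf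
  have hnil : (Finsupp.mapDomain List.reverse f : TA K d) [] = 0 := by
    rw [← List.reverse_nil, Finsupp.mapDomain_apply List.reverse_injective, hf.1]
  have hs : start f = pend 0 (Finsupp.mapDomain List.reverse f) := rfl
  rw [hoffExpL_eq, hoffRevL_eq_sum_absorb hnil (n := 2) (by rw [← hs]; simpa [pow_two] using hf.2),
    ← hs]
  simp [Finset.sum_range_succ, hs, finish_pend]

end Areas

/-- Hoffman's exponential is a tortkara morphism on the space `D = ⨁ₙ Dₙ` of
areas-of-areas: `Φ_H(area(φ, ψ)) = darea(Φ_H(φ), Φ_H(ψ))`. -/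
theorem hoffman_tortkara_morphism {K : Type*} [Field K] [CharZero K] {d : ℕ}
    (φ ψ : TA K d) (hφ : φ ∈ ⨆ n : ℕ, Dsp (K := K) (d := d) n)
    (hψ : ψ ∈ ⨆ n : ℕ, Dsp (K := K) (d := d) n) :
    hoffExpL (areaL φ ψ) = dareaL (hoffExpL φ) (hoffExpL ψ) := by
  have hφ' : φ ∈ areaLike := iSup_le Dsp_le_areaLike hφ
  have hψ' : ψ ∈ areaLike := iSup_le Dsp_le_areaLike hψ
  rw [hoffExpL_of_mem_areaLike (areaL_mem_areaLike hφ' hψ'), areaL_eq, dareaL_eq]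
  simp only [map_sub, finish_absorb_start_halfShuffle]
  rw [← hoffExpL_of_mem_areaLike hφ', ← hoffExpL_of_mem_areaLike hψ']

end TimeWarp
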